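/- arXiv:1210.3896 — 2 statements merged into one kernel-verified Lean document; each statement's English description precedes it below -/
import Mathlib

section
/- Let φ: U → V be a C^∞ diffeomorphism between open subsets of ℝⁿ whose Jacobian determinant J = det Dφ is everywhere positive. Let Δf = (1/2)(S^{ab}∂_a∂_b f + T^a∂_a f + Rf) be a second-order operator on C^∞(U) with smooth coefficients and S^{ab} = S^{ba}. Define the pushed-forward operator Δ' on C^∞(V) by Δ'f = (Δ(f∘φ))∘φ^{−1}, and write it as Δ'f = (1/2)(S'^{ab}∂_a∂_b f + T'^a∂_a f + R'f) with S'^{ab} = S'^{ba} (such coefficients exist and are unique). Then the principal symbols are related by S'^{ab} = (∂_cφ^a · ∂_dφ^b · S^{cd})∘φ^{−1}, and the subprincipal symbols γ^a := ∂_b S^{ab} − T^a and γ'^a := ∂_b S'^{ab} − T'^a satisfy the transformation law of an upper connection on volume forms: γ'^a = (∂_cφ^a·(γ^c + S^{cd}∂_d log J))∘φ^{−1}. -/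
open MeasureTheory Real

/-- Partial derivative of a function on ℝⁿ in the direction of the `a`-th coordinate. -/
noncomputable def pd {n : ℕ} (a : Fin n) (f : (Fin n → ℝ) → ℝ) : (Fin n → ℝ) → ℝ :=
  fun x => fderiv ℝ f x (Pi.single a 1)

open scoped ContDiff

section PartialDerivative

variable {n : ℕ} {f g : (Fin n → ℝ) → ℝ} {x : Fin n → ℝ} {U : Set (Fin n → ℝ)}

theorem pd_congr_of_eqOn (hU : IsOpen U) (h : Set.EqOn f g U) (hx : x ∈ U) (a : Fin n) :
    pd a f x = pd a g x := by
  simp only [pd, (h.eventuallyEq_of_mem (hU.mem_nhds hx)).fderiv_eq]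

theorem pd_mul (hf : DifferentiableAt ℝ f x) (hg : DifferentiableAt ℝ g x) (a : Fin n) :
    pd a (fun z => f z * g z) x = pd a f x * g x + f x * pd a g x := by
  simp only [pd, fderiv_fun_mul hf hg, add_apply, smul_apply, smul_eq_mul]
  ring

theorem pd_add (hf : DifferentiableAt ℝ f x) (hg : DifferentiableAt ℝ g x) (a : Fin n) :
    pd a (fun z => f z + g z) x = pd a f x + pd a g x := by
  simp only [pd, fderiv_fun_add hf hg, add_apply]

theorem pd_sum {ι : Type*} (s : Finset ι) {F : ι → (Fin n → ℝ) → ℝ}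
    (hF : ∀ i ∈ s, DifferentiableAt ℝ (F i) x) (a : Fin n) :
    pd a (fun z => ∑ i ∈ s, F i z) x = ∑ i ∈ s, pd a (F i) x := by
  simp only [pd, fderiv_fun_sum hF, sum_apply]

theorem pd_sub_const (c : ℝ) (a : Fin n) : pd a (fun z => f z - c) = pd a f := by
  funext x
  simp only [pd, fderiv_sub_const]

theorem pd_const (c : ℝ) (a : Fin n) : pd a (fun _ => c) = fun _ => 0 := by
  funext x
  simp [pd]

theorem pd_apply (a b : Fin n) : pd a (fun z => z b) = fun _ => if b = a then 1 else 0 := by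
  funext x
  simp [pd, fderiv_apply, Pi.single_apply]

theorem pd_log (hf : DifferentiableAt ℝ f x) (hx : f x ≠ 0) (a : Fin n) :
    pd a (fun z => Real.log (f z)) x = (f x)⁻¹ * pd a f x := by
  simp only [pd, fderiv.log hf hx, smul_apply, smul_eq_mul]

theorem pd_comp {φ : (Fin n → ℝ) → (Fin n → ℝ)} (hf : DifferentiableAt ℝ f (φ x))
    (hφ : DifferentiableAt ℝ φ x) (a : Fin n) :
    pd a (fun z => f (φ z)) x = ∑ b, pd b f (φ x) * pd a (fun z => φ z b) x := by
  have hcomp : fderiv ℝ (fun z => f (φ z)) x = (fderiv ℝ f (φ x)).comp (fderiv ℝ φ x) :=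
    fderiv_comp x hf hφ
  have hcoord : ∀ b, pd a (fun z => φ z b) x = fderiv ℝ φ x (Pi.single a 1) b := fun b => by
    rw [pd, fderiv_pi (differentiableAt_pi.1 hφ)]
    rfl
  simp only [hcoord]
  simp only [pd, hcomp, ContinuousLinearMap.comp_apply]
  conv_lhs => rw [pi_eq_sum_univ' (fderiv ℝ φ x (Pi.single a 1))]
  simp [map_sum, mul_comm]

theorem ContDiffOn.differentiableAt_of_isOpen (hf : ContDiffOn ℝ ∞ f U) (hU : IsOpen U)
    (hx : x ∈ U) : DifferentiableAt ℝ f x :=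
  (hf.contDiffAt (hU.mem_nhds hx)).differentiableAt (by simp)

theorem ContDiffOn.pd (hf : ContDiffOn ℝ ∞ f U) (hU : IsOpen U) (a : Fin n) :
    ContDiffOn ℝ ∞ (pd a f) U :=
  (hf.fderiv_of_isOpen hU (by simp)).clm_apply contDiffOn_const

theorem pd_pd_comm (hf : ContDiffOn ℝ ∞ f U) (hU : IsOpen U) (hx : x ∈ U) (a b : Fin n) :
    pd a (pd b f) x = pd b (pd a f) x := by
  have hd : DifferentiableAt ℝ (fderiv ℝ f) x :=
    ((hf.fderiv_of_isOpen hU (m := ∞) (by simp)).contDiffAt (hU.mem_nhds hx)).differentiableAt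
      (by simp)
  have key : ∀ a b : Fin n, pd a (pd b f) x
      = fderiv ℝ (fderiv ℝ f) x (Pi.single a 1) (Pi.single b 1) := fun a b => by
    have : pd b f = fun z => fderiv ℝ f z (Pi.single b 1) := rfl
    rw [this, pd, fderiv_clm_apply hd (differentiableAt_const _)]
    simp
  rw [key, key]
  refine (hf.contDiffAt (hU.mem_nhds hx)).isSymmSndFDerivAt ?_ _ _
  rw [minSmoothness_of_isRCLikeNormedField]
  exact WithTop.coe_le_coe.2 le_top

theorem pd_pd_mul_of_eq_zero (hf : ContDiffOn ℝ ∞ f U) (hg : ContDiffOn ℝ ∞ g U)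
    (hU : IsOpen U) (hx : x ∈ U) (hfx : f x = 0) (hgx : g x = 0) (a b : Fin n) :
    pd a (pd b fun z => f z * g z) x = pd a f x * pd b g x + pd b f x * pd a g x := by
  have df : ∀ z ∈ U, DifferentiableAt ℝ f z := fun z => hf.differentiableAt_of_isOpen hU
  have dg : ∀ z ∈ U, DifferentiableAt ℝ g z := fun z => hg.differentiableAt_of_isOpen hU
  have dpf := (hf.pd hU b).differentiableAt_of_isOpen hU hx
  have dpg := (hg.pd hU b).differentiableAt_of_isOpen hU hx
  rw [pd_congr_of_eqOn hU (fun z hz => pd_mul (df z hz) (dg z hz) b) hx,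
    pd_add (dpf.fun_mul (dg x hx)) ((df x hx).fun_mul dpg), pd_mul dpf (dg x hx), pd_mul (df x hx) dpg,
    hfx, hgx]
  ring

/-- Jacobi's formula for the partial derivatives of a determinant. -/
theorem pd_det {A : (Fin n → ℝ) → Matrix (Fin n) (Fin n) ℝ}
    (hA : ∀ i j, DifferentiableAt ℝ (fun z => A z i j) x) (a : Fin n) :
    pd a (fun z => (A z).det) x
      = ∑ i, ∑ j, (A x).adjugate j i * pd a (fun z => A z i j) x := by
  let D : ContinuousMultilinearMap ℝ (fun _ : Fin n => Fin n → ℝ) ℝ :=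
    { (Matrix.detRowAlternating (R := ℝ) (n := Fin n)).toMultilinearMap with
      cont := Continuous.matrix_det (A := fun M : Matrix (Fin n) (Fin n) ℝ => M) continuous_id }
  have hrow : ∀ i, HasFDerivAt (fun z => A z i) (fderiv ℝ (fun z => A z i) x) x := fun i =>
    (differentiableAt_pi.2 (hA i)).hasFDerivAt
  have hD : HasFDerivAt (fun z => (A z).det) _ x := HasFDerivAt.multilinear_comp D hrow
  rw [pd, hD.fderiv, sum_apply]
  refine Finset.sum_congr rfl fun i _ => ?_
  have hcoord : fderiv ℝ (fun z => A z i) x (Pi.single a 1)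
      = fun j => pd a (fun z => A z i j) x := by
    rw [fderiv_pi (hA i)]
    rfl
  rw [ContinuousLinearMap.comp_apply, hcoord]
  change ((A x).updateRow i (fun j => pd a (fun z => A z i j) x)).det = _
  rw [← Matrix.cramer_transpose_apply, Matrix.cramer_eq_adjugate_mulVec,
    ← Matrix.adjugate_transpose]
  rfl

end PartialDerivative

/-- The trace of `P`, when `P * A` is given by a product rule expansion and `B` is the inverse of `A`. -/
theorem sum_diag_of_mul_eq {ι : Type*} [Fintype ι] [DecidableEq ι] {A B P : Matrix ι ι ℝ}
    {h : ι → ι → ℝ} {H : ι → ι → ι → ℝ} {s : ι → ι → ℝ} {Ds : ι → ι → ι → ℝ} {v : ι → ℝ}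
    (hAB : A * B = 1) (hBA : B * A = 1)
    (hP : ∀ b e, ∑ b', P b b' * A b' e = ∑ c, ∑ d,
      (h e c * A b d * s c d + v c * H b e d * s c d + v c * A b d * Ds e c d)) :
    ∑ b, P b b = (∑ c, ∑ d, s c d * h d c)
      + ∑ c, v c * ((∑ d, Ds d c d) + ∑ d, s c d * ∑ b, ∑ e, B e b * H b e d) := by
  have hBA' : ∀ e d, ∑ b, B e b * A b d = if e = d then 1 else 0 := fun e d => by
    rw [← Matrix.mul_apply, hBA, Matrix.one_apply]
  have hPB : P = Matrix.of (fun b e => ∑ c, ∑ d,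
      (h e c * A b d * s c d + v c * H b e d * s c d + v c * A b d * Ds e c d)) * B := by
    rw [← mul_one P, ← hAB, ← mul_assoc]
    congr 1
    ext b e
    rw [Matrix.mul_apply, hP, Matrix.of_apply]
  calc ∑ b, P b b
      = ∑ b, ∑ e, (∑ c, ∑ d, (h e c * A b d * s c d + v c * H b e d * s c d
          + v c * A b d * Ds e c d)) * B e b := by
        conv_lhs => rw [hPB]
        rfl
    _ = ∑ c, ∑ d, ∑ e, ∑ b, (h e c * A b d * s c d + v c * H b e d * s c d
          + v c * A b d * Ds e c d) * B e b := by
        simp only [Finset.sum_mul]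
        rw [Finset.sum_comm]
        rw [Finset.sum_congr rfl fun e _ => Finset.sum_comm, Finset.sum_comm]
        refine Finset.sum_congr rfl fun c _ => ?_
        rw [Finset.sum_congr rfl fun e _ => Finset.sum_comm, Finset.sum_comm]
    _ = ∑ c, ∑ d, ∑ e, (h e c * s c d * (∑ b, B e b * A b d)
          + v c * Ds e c d * (∑ b, B e b * A b d)
          + v c * (s c d * ∑ b, B e b * H b e d)) := by
        refine Finset.sum_congr rfl fun c _ => Finset.sum_congr rfl fun d _ =>
          Finset.sum_congr rfl fun e _ => ?_
        simp only [Finset.mul_sum, ← Finset.sum_add_distrib]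
        exact Finset.sum_congr rfl fun b _ => by ring
    _ = _ := by
        simp only [hBA', Finset.sum_add_distrib, mul_ite, mul_one, mul_zero, Finset.sum_ite_eq',
          Finset.mem_univ, if_true, mul_add, Finset.mul_sum, add_assoc]
        congr 1
        · exact Finset.sum_congr rfl fun c _ => Finset.sum_congr rfl fun d _ => mul_comm _ _
        · congr 1
          exact Finset.sum_congr rfl fun c _ => Finset.sum_congr rfl fun d _ => Finset.sum_comm

/-- under a diffeomorphism with positive Jacobian, the principal symbol of a
second order operator transforms as a contravariant 2-tensor and the subprincipal symbol
`γ^a = ∂_b S^{ab} − T^a` transforms as an upper connection on volume forms. -/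
theorem statement1 (n : ℕ) (U V : Set (Fin n → ℝ)) (hU : IsOpen U) (hV : IsOpen V)
    (φ ψ : (Fin n → ℝ) → (Fin n → ℝ))
    (hφ : ContDiffOn ℝ (⊤ : ℕ∞) φ U) (hψ : ContDiffOn ℝ (⊤ : ℕ∞) ψ V)
    (hφUV : Set.MapsTo φ U V) (hψVU : Set.MapsTo ψ V U)
    (hleft : ∀ x ∈ U, ψ (φ x) = x) (hright : ∀ y ∈ V, φ (ψ y) = y)
    (J : (Fin n → ℝ) → ℝ)
    (hJ : ∀ x, J x = Matrix.det (Matrix.of fun a c : Fin n => pd c (fun y => φ y a) x))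
    (hJpos : ∀ x ∈ U, 0 < J x)
    -- the operator Δ on C^∞(U), with smooth coefficients, S symmetric
    (S : Fin n → Fin n → (Fin n → ℝ) → ℝ) (T : Fin n → (Fin n → ℝ) → ℝ)
    (R : (Fin n → ℝ) → ℝ)
    (hS : ∀ a b, ContDiffOn ℝ (⊤ : ℕ∞) (S a b) U) (hSsymm : ∀ a b, S a b = S b a)
    (hT : ∀ a, ContDiffOn ℝ (⊤ : ℕ∞) (T a) U) (hR : ContDiffOn ℝ (⊤ : ℕ∞) R U)
    -- the pushed-forward operator Δ' on C^∞(V), written with coefficients S', T', R'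
    (S' : Fin n → Fin n → (Fin n → ℝ) → ℝ) (T' : Fin n → (Fin n → ℝ) → ℝ)
    (R' : (Fin n → ℝ) → ℝ)
    (hS' : ∀ a b, ContDiffOn ℝ (⊤ : ℕ∞) (S' a b) V) (hS'symm : ∀ a b, S' a b = S' b a)
    (hT' : ∀ a, ContDiffOn ℝ (⊤ : ℕ∞) (T' a) V) (hR' : ContDiffOn ℝ (⊤ : ℕ∞) R' V)
    -- Δ'f = (Δ(f∘φ))∘φ⁻¹ :
    (hpush : ∀ f : (Fin n → ℝ) → ℝ, ContDiff ℝ (⊤ : ℕ∞) f → ∀ y ∈ V,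
      (1/2) * (∑ a, ∑ b, S' a b y * pd a (pd b f) y + ∑ a, T' a y * pd a f y + R' y * f y)
      = (1/2) * (∑ a, ∑ b, S a b (ψ y) * pd a (pd b (fun z => f (φ z))) (ψ y)
          + ∑ a, T a (ψ y) * pd a (fun z => f (φ z)) (ψ y) + R (ψ y) * f (φ (ψ y)))) :
    -- (a) the principal symbol transforms as a tensor:
    (∀ y ∈ V, ∀ a b,
      S' a b y = ∑ c, ∑ d, pd c (fun z => φ z a) (ψ y) * pd d (fun z => φ z b) (ψ y)
        * S c d (ψ y))
    ∧
    -- (b) γ^a = ∂_b S^{ab} − T^a transforms as an upper connection on volume forms: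
    (∀ y ∈ V, ∀ a,
      (∑ b, pd b (S' a b) y) - T' a y
      = ∑ c, pd c (fun z => φ z a) (ψ y) *
          (((∑ b, pd b (S c b) (ψ y)) - T c (ψ y))
            + ∑ d, S c d (ψ y) * pd d (fun z => Real.log (J z)) (ψ y))) := by
  have φs : ∀ a, ContDiffOn ℝ ∞ (fun z => φ z a) U := contDiffOn_pi.1 hφ
  have φd : ∀ a, ∀ x ∈ U, DifferentiableAt ℝ (fun z => φ z a) x := fun a x =>
    (φs a).differentiableAt_of_isOpen hU
  have coord : ∀ a : Fin n, ContDiff ℝ ∞ (fun z : Fin n → ℝ => z a) := fun a =>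
    contDiff_apply ℝ ℝ a
  have principal : ∀ y ∈ V, ∀ a b,
      S' a b y = ∑ c, ∑ d, pd c (fun z => φ z a) (ψ y) * pd d (fun z => φ z b) (ψ y)
        * S c d (ψ y) := by
    intro y hy a b
    have hx := hψVU hy
    have e := hpush (fun z => (z a - y a) * (z b - y b))
      (((coord a).sub contDiff_const).mul ((coord b).sub contDiff_const)) y hy
    have hl : ∀ c d, pd c (pd d fun z : Fin n → ℝ => (z a - y a) * (z b - y b)) y
        = (if a = c then 1 else 0) * (if b = d then 1 else 0)
          + (if a = d then 1 else 0) * (if b = c then 1 else 0) := fun c d => by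
      rw [pd_pd_mul_of_eq_zero ((coord a).sub contDiff_const).contDiffOn
        ((coord b).sub contDiff_const).contDiffOn isOpen_univ (Set.mem_univ y)
        (sub_self _) (sub_self _)]
      simp only [pd_sub_const, pd_apply]
    have hl' : ∀ c, pd c (fun z : Fin n → ℝ => (z a - y a) * (z b - y b)) y = 0 := fun c => by
      rw [pd_mul (by fun_prop) (by fun_prop)]
      simp
    have hr : ∀ c d, pd c (pd d fun z => (φ z a - y a) * (φ z b - y b)) (ψ y)
        = pd c (fun z => φ z a) (ψ y) * pd d (fun z => φ z b) (ψ y)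
          + pd d (fun z => φ z a) (ψ y) * pd c (fun z => φ z b) (ψ y) := fun c d => by
      rw [pd_pd_mul_of_eq_zero ((φs a).sub contDiffOn_const) ((φs b).sub contDiffOn_const) hU hx
        (by rw [hright y hy, sub_self]) (by rw [hright y hy, sub_self])]
      simp only [pd_sub_const]
    have hr' : ∀ c, pd c (fun z => (φ z a - y a) * (φ z b - y b)) (ψ y) = 0 := fun c => by
      rw [pd_mul ((φd a _ hx).sub_const _) ((φd b _ hx).sub_const _), hright y hy]
      simp
    simp only [hl, hl', hr, hr', hright y hy, sub_self, mul_zero, Finset.sum_const_zero, add_zero,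
      mul_add, Finset.sum_add_distrib] at e
    have hswap : ∑ c, ∑ d, S c d (ψ y)
          * (pd d (fun z => φ z a) (ψ y) * pd c (fun z => φ z b) (ψ y))
        = ∑ c, ∑ d, S c d (ψ y)
          * (pd c (fun z => φ z a) (ψ y) * pd d (fun z => φ z b) (ψ y)) := by
      rw [Finset.sum_comm]
      exact Finset.sum_congr rfl fun c _ => Finset.sum_congr rfl fun d _ => by rw [hSsymm]
    rw [hswap] at e
    simp only [mul_ite, mul_one, mul_zero, Finset.sum_ite_eq,
      Finset.mem_univ, if_true, Finset.sum_const_zero, Finset.sum_ite_irrel, hS'symm b a] at e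
    rw [Finset.sum_congr rfl fun c _ => Finset.sum_congr rfl fun d _ => mul_comm _ (S c d (ψ y))]
    linarith
  refine ⟨principal, fun y hy a => ?_⟩
  have hx := hψVU hy
  have hT'y : T' a y = (∑ c, ∑ d, S c d (ψ y) * pd c (pd d fun z => φ z a) (ψ y))
      + ∑ c, T c (ψ y) * pd c (fun z => φ z a) (ψ y) := by
    have e := hpush (fun z => z a - y a) ((coord a).sub contDiff_const) y hy
    simp only [pd_sub_const, pd_apply, pd_const, hright y hy, sub_self, mul_zero,
      Finset.sum_const_zero, add_zero, zero_add, mul_ite, mul_one, Finset.sum_ite_eq,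
      Finset.mem_univ, if_true] at e
    linarith
  let A : (Fin n → ℝ) → Matrix (Fin n) (Fin n) ℝ :=
    fun x => Matrix.of fun a c => pd c (fun z => φ z a) x
  have hJA : J = fun z => (A z).det := funext hJ
  have Ad : ∀ i j, DifferentiableAt ℝ (fun z => A z i j) (ψ y) := fun i j =>
    ((φs i).pd hU j).differentiableAt_of_isOpen hU hx
  have hdet : IsUnit (A (ψ y)).det := by
    have := hJpos _ hx
    rw [hJA] at this
    exact this.ne'.isUnit
  have hlog : ∀ d, pd d (fun z => Real.log (J z)) (ψ y)
      = ∑ b, ∑ e, (A (ψ y))⁻¹ e b * pd e (pd d fun z => φ z b) (ψ y) := by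
    intro d
    have Jd : DifferentiableAt ℝ (fun z => (A z).det) (ψ y) := by
      simp only [Matrix.det_apply]
      fun_prop
    rw [hJA, pd_log Jd hdet.ne_zero, pd_det Ad, Finset.mul_sum]
    refine Finset.sum_congr rfl fun b _ => ?_
    rw [Finset.mul_sum]
    refine Finset.sum_congr rfl fun e _ => ?_
    rw [Matrix.inv_def, Ring.inverse_eq_inv', Matrix.smul_apply, smul_eq_mul, mul_assoc,
      pd_pd_comm (φs b) hU hx e d]
    rfl
  have hdiff : ∀ b e, ∑ b', pd b' (S' a b) y * A (ψ y) b' e = ∑ c, ∑ d,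
      (pd e (pd c fun z => φ z a) (ψ y) * A (ψ y) b d * S c d (ψ y)
        + A (ψ y) a c * pd e (pd d fun z => φ z b) (ψ y) * S c d (ψ y)
        + A (ψ y) a c * A (ψ y) b d * pd e (S c d) (ψ y)) := by
    intro b e
    have hS'd : DifferentiableAt ℝ (S' a b) (φ (ψ y)) :=
      (hS' a b).differentiableAt_of_isOpen hV ((hright y hy).symm ▸ hy)
    have hchain := pd_comp hS'd (differentiableAt_pi.2 fun i => φd i _ hx) e
    rw [hright y hy] at hchain
    refine hchain.symm.trans ?_
    have hcongr : Set.EqOn (fun z => S' a b (φ z))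
        (fun z => ∑ c, ∑ d, A z a c * A z b d * S c d z) U := fun z hz => by
      have := principal (φ z) (hφUV hz) a b
      rwa [hleft z hz] at this
    have Sd : ∀ c d, DifferentiableAt ℝ (S c d) (ψ y) := fun c d =>
      (hS c d).differentiableAt_of_isOpen hU hx
    rw [pd_congr_of_eqOn hU hcongr hx, pd_sum _ fun c _ => by fun_prop]
    refine Finset.sum_congr rfl fun c _ => ?_
    rw [pd_sum _ fun d _ => by fun_prop]
    refine Finset.sum_congr rfl fun d _ => ?_
    rw [pd_mul ((Ad a c).fun_mul (Ad b d)) (Sd c d), pd_mul (Ad a c) (Ad b d), add_mul]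
    rfl
  have hdiv := sum_diag_of_mul_eq (P := Matrix.of fun b b' => pd b' (S' a b) y)
    (Matrix.mul_nonsing_inv _ hdet) (Matrix.nonsing_inv_mul _ hdet) hdiff
  simp only [Matrix.of_apply] at hdiv
  simp only [hdiv, hT'y, hlog]
  have hcomm : ∑ c, ∑ d, S c d (ψ y) * pd c (pd d fun z => φ z a) (ψ y)
      = ∑ c, ∑ d, S c d (ψ y) * pd d (pd c fun z => φ z a) (ψ y) :=
    Finset.sum_congr rfl fun c _ => Finset.sum_congr rfl fun d _ => by
      rw [pd_pd_comm (φs a) hU hx]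
  rw [hcomm, add_sub_add_left_eq_sub, ← Finset.sum_sub_distrib]
  refine Finset.sum_congr rfl fun c _ => ?_
  change pd c (fun z => φ z a) (ψ y) * _ - _ = _
  ring
end

section
/- Let δ ∈ ℝ, let S^{ab} = S^{ba} be smooth functions on ℝⁿ, and let γ_a, γ'_a be smooth covector fields with X_a := γ'_a − γ_a. Define the operator Δ_sing(S,γ)f = (1/2)(S^{ab}∂_a∂_b f + (∂_b S^{ba})∂_a f + ((1−δ)/2)(∂_a(S^{ab}γ_b) + ((δ−1)/2)γ_a S^{ab}γ_b)·f) on smooth functions f. Then Δ_sing(S,γ') − Δ_sing(S,γ) is the operator of multiplication by ((1−δ)/4)(div_γ X + ((δ−1)/2)⟨X,X⟩), where div_γ X = ∂_a(S^{ab}X_b) + (δ−1)γ_a S^{ab}X_b and ⟨X,X⟩ = X_a S^{ab}X_b. Consequently, for δ ≠ 1, Δ_sing(S,γ') = Δ_sing(S,γ) if and only if div_γ X + ((δ−1)/2)⟨X,X⟩ = 0. -/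
open MeasureTheory Real

/-- The operator `Δ_sing(S,γ)` of weight `δ` acting on densities of weight `(1−δ)/2`,
written in coordinates. -/
noncomputable def deltaSing {n : ℕ} (δ : ℝ) (S : Fin n → Fin n → (Fin n → ℝ) → ℝ)
    (γ : Fin n → (Fin n → ℝ) → ℝ) (f : (Fin n → ℝ) → ℝ) (x : Fin n → ℝ) : ℝ :=
  (1/2) * (∑ a, ∑ b, S a b x * pd a (pd b f) x
    + ∑ a, (∑ b, pd b (S b a) x) * pd a f x
    + ((1 - δ)/2) * ((∑ a, pd a (fun y => ∑ b, S a b y * γ b y) x)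
        + ((δ - 1)/2) * ∑ a, ∑ b, γ a x * S a b x * γ b x) * f x)

/-- The divergence `div_γ X = ∂_a(S^{ab}X_b) + (δ−1) γ_a S^{ab} X_b`. -/
noncomputable def divg {n : ℕ} (δ : ℝ) (S : Fin n → Fin n → (Fin n → ℝ) → ℝ)
    (γ X : Fin n → (Fin n → ℝ) → ℝ) (x : Fin n → ℝ) : ℝ :=
  ∑ a, pd a (fun y => ∑ b, S a b y * X b y) x + (δ - 1) * ∑ a, ∑ b, γ a x * S a b x * X b x

/-- Each summand of the divergence `∂_a (S^{ab} X_b)` is additive in the covector field. -/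
theorem pd_contraction_sub {n : ℕ} (a : Fin n) (S γ γ' X : Fin n → (Fin n → ℝ) → ℝ)
    (hS : ∀ b, Differentiable ℝ (S b)) (hγ : ∀ b, Differentiable ℝ (γ b))
    (hγ' : ∀ b, Differentiable ℝ (γ' b)) (hX : ∀ b x, X b x = γ' b x - γ b x)
    (x : Fin n → ℝ) :
    pd a (fun y => ∑ b, S b y * X b y) x
      = pd a (fun y => ∑ b, S b y * γ' b y) x - pd a (fun y => ∑ b, S b y * γ b y) x := by
  have hsum : ∀ η : Fin n → (Fin n → ℝ) → ℝ, (∀ b, Differentiable ℝ (η b)) →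
      DifferentiableAt ℝ (fun y => ∑ b, S b y * η b y) x := fun η hη =>
    DifferentiableAt.fun_sum fun b _ => ((hS b).mul (hη b)) x
  have hfun : (fun y => ∑ b, S b y * X b y)
      = fun y => (∑ b, S b y * γ' b y) - ∑ b, S b y * γ b y := by
    funext y
    simp only [hX, mul_sub, Finset.sum_sub_distrib]
  unfold pd
  rw [hfun, fderiv_fun_sub (hsum γ' hγ') (hsum γ hγ), sub_apply]

/-- Polarization of the quadratic form of a symmetric matrix. -/
theorem sum_symm_quadratic_sub {ι : Type*} [Fintype ι] (M : ι → ι → ℝ)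
    (hM : ∀ a b, M a b = M b a) (u v : ι → ℝ) :
    (∑ a, ∑ b, v a * M a b * v b) - ∑ a, ∑ b, u a * M a b * u b
      = 2 * (∑ a, ∑ b, u a * M a b * (v b - u b))
        + ∑ a, ∑ b, (v a - u a) * M a b * (v b - u b) := by
  have hcross : ∑ a, ∑ b, v a * M a b * u b = ∑ a, ∑ b, u a * M a b * v b := by
    rw [Finset.sum_comm]
    refine Finset.sum_congr rfl fun b _ => Finset.sum_congr rfl fun a _ => ?_
    rw [hM a b]
    ring
  simp only [mul_sub, sub_mul, Finset.sum_sub_distrib]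
  linarith

/-- the difference `Δ_sing(S,γ') − Δ_sing(S,γ)` is the multiplication
operator by `((1−δ)/4)(div_γ X + ((δ−1)/2)⟨X,X⟩)` with `X = γ' − γ`; hence for `δ ≠ 1`
the operators coincide exactly when the groupoid equation holds. -/
theorem statement9 (n : ℕ) (δ : ℝ)
    (S : Fin n → Fin n → (Fin n → ℝ) → ℝ) (γ γ' X : Fin n → (Fin n → ℝ) → ℝ)
    (hS : ∀ a b, ContDiff ℝ (⊤ : ℕ∞) (S a b)) (hSsymm : ∀ a b, S a b = S b a)
    (hγ : ∀ a, ContDiff ℝ (⊤ : ℕ∞) (γ a)) (hγ' : ∀ a, ContDiff ℝ (⊤ : ℕ∞) (γ' a))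
    (hX : ∀ a x, X a x = γ' a x - γ a x) :
    (∀ f : (Fin n → ℝ) → ℝ, ContDiff ℝ (⊤ : ℕ∞) f → ∀ x,
      deltaSing δ S γ' f x - deltaSing δ S γ f x
        = ((1 - δ)/4) * (divg δ S γ X x
            + ((δ - 1)/2) * ∑ a, ∑ b, X a x * S a b x * X b x) * f x)
    ∧
    (δ ≠ 1 →
      ((∀ f : (Fin n → ℝ) → ℝ, ContDiff ℝ (⊤ : ℕ∞) f → ∀ x,
          deltaSing δ S γ' f x = deltaSing δ S γ f x)
        ↔ (∀ x, divg δ S γ X x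
            + ((δ - 1)/2) * ∑ a, ∑ b, X a x * S a b x * X b x = 0))) := by
  have hdiff : ∀ {g : (Fin n → ℝ) → ℝ}, ContDiff ℝ (⊤ : ℕ∞) g → Differentiable ℝ g :=
    fun hg => hg.differentiable (by simp)
  have hmul : ∀ (f : (Fin n → ℝ) → ℝ) (x : Fin n → ℝ),
      deltaSing δ S γ' f x - deltaSing δ S γ f x
        = ((1 - δ)/4) * (divg δ S γ X x
            + ((δ - 1)/2) * ∑ a, ∑ b, X a x * S a b x * X b x) * f x := by
    intro f x
    have hdiv := Finset.sum_congr (rfl : (Finset.univ : Finset (Fin n)) = Finset.univ)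
      fun a _ => pd_contraction_sub a (S a) γ γ' X (fun b => hdiff (hS a b))
        (fun b => hdiff (hγ b)) (fun b => hdiff (hγ' b)) hX x
    rw [Finset.sum_sub_distrib] at hdiv
    have hquad := sum_symm_quadratic_sub (fun a b => S a b x)
      (fun a b => congrFun (hSsymm a b) x) (fun a => γ a x) (fun a => γ' a x)
    simp only [← hX] at hquad
    unfold deltaSing divg
    rw [hdiv]
    linear_combination ((1 - δ) / 4 * ((δ - 1) / 2) * f x) * hquad
  refine ⟨fun f _ => hmul f, fun hδ => ⟨fun h x => ?_, fun h f _ x => ?_⟩⟩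
  · have hone := hmul (fun _ => 1) x
    rw [h _ contDiff_const x, sub_self, mul_one] at hone
    exact (mul_eq_zero.mp hone.symm).resolve_left
      (div_ne_zero (sub_ne_zero.mpr hδ.symm) four_ne_zero)
  · rw [← sub_eq_zero, hmul f x, h x, mul_zero, zero_mul]
end
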